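/- Let G be a connected undirected graph on N nodes with 0-1 adjacency weights a_{ij}, let g₁,…,g_N ∈ ℝ^q satisfy ‖gᵢ‖ ≤ K_g and Σᵢ gᵢ ≤ 0 componentwise, and let μ₁,…,μ_N ∈ ℝ₊^q. If K_μ ≥ N·K_g, then Σᵢ μᵢᵀ gᵢ − K_μ Σᵢ Σⱼ a_{ij}‖μᵢ − μⱼ‖₁ ≤ 0. -/

import Mathlib

/-- Along a path, the endpoint difference of a vertex function is at most the sum of the
edge differences at the vertices of the path. -/
theorem SimpleGraph.Walk.IsPath.abs_sub_le_sum_support {V : Type*} [Fintype V] [DecidableEq V]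
    {G : SimpleGraph V} [DecidableRel G.Adj] (x : V → ℝ) {u v : V} {p : G.Walk u v}
    (hp : p.IsPath) :
    |x u - x v| ≤
      ∑ a ∈ p.support.toFinset, ∑ b, (if G.Adj a b then (1 : ℝ) else 0) * |x a - x b| := by
  induction p with
  | nil =>
    rw [sub_self, abs_zero]
    positivity
  | @cons u w v h p ih =>
    rw [SimpleGraph.Walk.cons_isPath_iff] at hp
    have hu : u ∉ p.support.toFinset := by simpa using hp.2
    rw [SimpleGraph.Walk.support_cons, List.toFinset_cons, Finset.sum_insert hu]
    have hedge : |x u - x w| ≤ ∑ b, (if G.Adj u b then (1 : ℝ) else 0) * |x u - x b| := by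
      have := Finset.single_le_sum
        (f := fun b => (if G.Adj u b then (1 : ℝ) else 0) * |x u - x b|)
        (fun b _ => by positivity) (Finset.mem_univ w)
      simpa [h] using this
    exact (abs_sub_le _ (x w) _).trans (add_le_add hedge (ih hp.1))

/-- On a connected graph, the total edge disagreement controls all pairwise differences. -/
theorem SimpleGraph.Connected.abs_sub_le_sum {V : Type*} [Fintype V]
    {G : SimpleGraph V} [DecidableRel G.Adj] (hG : G.Connected) (x : V → ℝ) (u v : V) :
    |x u - x v| ≤ ∑ a, ∑ b, (if G.Adj a b then (1 : ℝ) else 0) * |x a - x b| := by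
  classical
  obtain ⟨p, hp⟩ := hG.exists_isPath u v
  exact (hp.abs_sub_le_sum_support x).trans <|
    Finset.sum_le_sum_of_subset_of_nonneg (Finset.subset_univ _) fun _ _ _ => by positivity

/-- Scalar version of the penalty bound. -/
theorem SimpleGraph.Connected.sum_mul_le {V : Type*} [Fintype V]
    {G : SimpleGraph V} [DecidableRel G.Adj] (hG : G.Connected) {c C : ℝ} {g x : V → ℝ}
    (hc : ∀ i, |g i| ≤ c) (hg : ∑ i, g i ≤ 0) (hx : ∀ i, 0 ≤ x i)
    (hC : (Fintype.card V : ℝ) * c ≤ C) :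
    ∑ i, x i * g i ≤ C * ∑ i, ∑ j, (if G.Adj i j then (1 : ℝ) else 0) * |x i - x j| := by
  obtain ⟨o⟩ := hG.nonempty
  set h := ∑ i, ∑ j, (if G.Adj i j then (1 : ℝ) else 0) * |x i - x j|
  have hh : 0 ≤ h := by positivity
  have hterm (i : V) : (x i - x o) * g i ≤ h * c := by
    refine (le_abs_self _).trans ?_
    rw [abs_mul]
    exact mul_le_mul (hG.abs_sub_le_sum x i o) (hc i) (abs_nonneg _) hh
  calc ∑ i, x i * g i = ∑ i, (x i - x o) * g i + x o * ∑ i, g i := by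
        rw [Finset.mul_sum, ← Finset.sum_add_distrib]
        exact Finset.sum_congr rfl fun i _ => by ring
    _ ≤ ∑ _i : V, h * c + 0 :=
        add_le_add (Finset.sum_le_sum fun i _ => hterm i)
          (mul_nonpos_of_nonneg_of_nonpos (hx o) hg)
    _ = (Fintype.card V : ℝ) * c * h := by
        simp only [Finset.sum_const, Finset.card_univ, nsmul_eq_mul]
        ring
    _ ≤ C * h := mul_le_mul_of_nonneg_right hC hh


/-- Inequality (th1c): with `K_μ ≥ N K_g`, nonnegative multipliers, bounded
constraints with `∑ᵢ gᵢ ≤ 0`, and a connected communication graph,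
`∑ᵢ μᵢᵀgᵢ - K_μ h(μ) ≤ 0`. -/
theorem stmt6 {N q : ℕ} (G : SimpleGraph (Fin N)) [DecidableRel G.Adj] (hG : G.Connected)
    (Kg Kμ : ℝ) (g μ : Fin N → Fin q → ℝ)
    (hKg : ∀ i, Real.sqrt (∑ k, (g i k) ^ 2) ≤ Kg)
    (hg : ∀ k, ∑ i, g i k ≤ 0)
    (hμ : ∀ i k, 0 ≤ μ i k)
    (hKμ : (N : ℝ) * Kg ≤ Kμ) :
    ∑ i, ∑ k, μ i k * g i k -
      Kμ * ∑ i, ∑ j, (if G.Adj i j then (1 : ℝ) else 0) * ∑ k, |μ i k - μ j k| ≤ 0 := by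
  have habs (i : Fin N) (k : Fin q) : |g i k| ≤ Kg :=
    (Real.abs_le_sqrt (Finset.single_le_sum (f := fun k => g i k ^ 2)
      (fun k _ => sq_nonneg _) (Finset.mem_univ k))).trans (hKg i)
  have hswap : ∑ i, ∑ j, (if G.Adj i j then (1 : ℝ) else 0) * ∑ k, |μ i k - μ j k| =
      ∑ k, ∑ i, ∑ j, (if G.Adj i j then (1 : ℝ) else 0) * |μ i k - μ j k| := by
    symm
    rw [Finset.sum_comm]
    refine Finset.sum_congr rfl fun i _ => ?_
    rw [Finset.sum_comm]
    exact Finset.sum_congr rfl fun j _ => (Finset.mul_sum _ _ _).symm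
  rw [sub_nonpos, hswap, Finset.mul_sum, Finset.sum_comm]
  exact Finset.sum_le_sum fun k _ => hG.sum_mul_le (fun i => habs i k) (hg k)
    (fun i => hμ i k) (by simpa using hKμ)
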